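/- Let k > 0, n ∈ C^1[0,1] real-valued, n_∞ ∈ ℝ, u_L ∈ ℂ, m ≥ 1, N(x) = ∫_0^x n, ξ = exp(ikN). Suppose: (a) u ∈ C^2[0,1] satisfies u'' + k²n²u = F on [0,1] with u(0) = u_L and u'(1) − ik n_∞ u(1) = 0; (b) μ_j, ν_j ∈ C^2[0,1] (j = 0,…,2m) satisfy 2nμ_j' + n'μ_j = iμ_{j-1}'', 2nν_j' + n'ν_j = −iν_{j-1}'' with μ_{-1} = ν_{-1} = 0, and r_j := μ_jξ + ν_jξ^{-1} satisfy the boundary conditions B_L r_0 = u_L, B_R r_0 = 0, B_L r_{2j-1} = B_R r_{2j-1} = 0, B_L r_{2j} = −F_{2j}(0), B_R r_{2j} = −B_R F_{2j}; (c) F_2 = F/n² and F_{2j+2} = −F_{2j}''/n² are well defined for j = 1,…,m with each F_{2j} ∈ C^2[0,1]. Set ũ^m := Σ_{j=0}^{2m} k^{-j} r_j + Σ_{j=1}^{m} k^{-2j} F_{2j} and e := u − ũ^m. Then e'' + k²n²e = k^{-2m}(n² F_{2m+2} − μ_{2m}'' ξ − ν_{2m}'' ξ^{-1}) on [0,1],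 and e satisfies the homogeneous boundary conditions e(0) = 0 and e'(1) − ik n_∞ e(1) = 0. -/

import Mathlib

open MeasureTheory

noncomputable section

/-- `N(x) = ∫_0^x n(x') dx'`. -/
def Nint (n : ℝ → ℝ) (x : ℝ) : ℝ := ∫ t in (0:ℝ)..x, n t

/-- `ξ(x) = exp(i k N(x))`. -/
def xiF (k : ℝ) (n : ℝ → ℝ) (x : ℝ) : ℂ := Complex.exp (Complex.I * ((k * Nint n x : ℝ) : ℂ))

/-- `ξ^{-1}(x) = exp(-i k N(x))`. -/
def xiInv (k : ℝ) (n : ℝ → ℝ) (x : ℝ) : ℂ := Complex.exp (-(Complex.I * ((k * Nint n x : ℝ) : ℂ)))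

/-- `r = μ ξ + ν ξ^{-1}`. -/
def rayFun (k : ℝ) (n : ℝ → ℝ) (μ ν : ℝ → ℂ) (x : ℝ) : ℂ :=
  μ x * xiF k n x + ν x * xiInv k n x

/-- The right boundary operator `B_R v = v'(1) - i k n_∞ v(1)`. -/
def BR (k nInf : ℝ) (v : ℝ → ℂ) : ℂ := deriv v 1 - Complex.I * (k : ℂ) * (nInf : ℂ) * v 1

end

lemma hasDerivAt_Nint {n : ℝ → ℝ} (hn : Continuous n) (x : ℝ) :
    HasDerivAt (Nint n) (n x) x :=
  intervalIntegral.integral_hasDerivAt_right (hn.intervalIntegrable _ _)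
    (hn.stronglyMeasurableAtFilter _ _) hn.continuousAt

lemma contDiff_Nint {n : ℝ → ℝ} (hn : ContDiff ℝ 1 n) : ContDiff ℝ 2 (Nint n) := by
  have hderiv : deriv (Nint n) = n := funext fun x => (hasDerivAt_Nint hn.continuous x).deriv
  rw [show (2 : WithTop ℕ∞) = 1 + 1 by norm_num, contDiff_succ_iff_deriv]
  exact ⟨fun x => (hasDerivAt_Nint hn.continuous x).differentiableAt, by simp, hderiv.symm ▸ hn⟩

lemma hasDerivAt_xiF (k : ℝ) {n : ℝ → ℝ} (hn : Continuous n) (x : ℝ) :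
    HasDerivAt (xiF k n) (Complex.I * k * n x * xiF k n x) x := by
  have h := ((((hasDerivAt_Nint hn x).const_mul k).ofReal_comp).const_mul Complex.I).cexp
  refine h.congr_deriv ?_
  simp only [xiF]
  push_cast
  ring

lemma hasDerivAt_xiInv (k : ℝ) {n : ℝ → ℝ} (hn : Continuous n) (x : ℝ) :
    HasDerivAt (xiInv k n) (-(Complex.I * k * n x) * xiInv k n x) x := by
  have h := ((((hasDerivAt_Nint hn x).const_mul k).ofReal_comp).const_mul Complex.I).fun_neg.cexp
  refine h.congr_deriv ?_
  simp only [xiInv]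
  push_cast
  ring

lemma contDiff_rayFun (k : ℝ) {n : ℝ → ℝ} (hn : ContDiff ℝ 1 n) {μ ν : ℝ → ℂ}
    (hμ : ContDiff ℝ 2 μ) (hν : ContDiff ℝ 2 ν) : ContDiff ℝ 2 (rayFun k n μ ν) := by
  have hphase : ContDiff ℝ 2 fun x => Complex.I * ((k * Nint n x : ℝ) : ℂ) :=
    contDiff_const.mul
      (Complex.ofRealCLM.contDiff.comp (contDiff_const.mul (contDiff_Nint hn)))
  exact (hμ.mul hphase.cexp).add (hν.mul hphase.neg.cexp)

lemma hasDerivAt_rayFun (k : ℝ) {n : ℝ → ℝ} (hn : Continuous n) {μ ν : ℝ → ℂ} {μ' ν' : ℂ} {x : ℝ}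
    (hμ : HasDerivAt μ μ' x) (hν : HasDerivAt ν ν' x) :
    HasDerivAt (rayFun k n μ ν)
      ((μ' + Complex.I * k * n x * μ x) * xiF k n x +
        (ν' - Complex.I * k * n x * ν x) * xiInv k n x) x := by
  refine ((hμ.mul (hasDerivAt_xiF k hn x)).add
    (hν.mul (hasDerivAt_xiInv k hn x))).congr_deriv ?_
  ring

lemma ContDiff.differentiable_of_two {f : ℝ → ℂ} (hf : ContDiff ℝ 2 f) : Differentiable ℝ f :=
  hf.differentiable (by norm_num)

lemma ContDiff.differentiable_deriv_of_two {f : ℝ → ℂ} (hf : ContDiff ℝ 2 f) :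
    Differentiable ℝ (deriv f) :=
  (ContDiff.deriv' (n := 1) (by simpa [one_add_one_eq_two] using hf)).differentiable (by norm_num)

/-- The Helmholtz operator applied to `μ ξ + ν ξ⁻¹`: the terms of order `k²` cancel. -/
lemma helmholtz_rayFun (k : ℝ) {n : ℝ → ℝ} (hn : ContDiff ℝ 1 n) {μ ν : ℝ → ℂ}
    (hμ : ContDiff ℝ 2 μ) (hν : ContDiff ℝ 2 ν) (x : ℝ) :
    deriv (deriv (rayFun k n μ ν)) x + (k : ℂ) ^ 2 * (n x : ℂ) ^ 2 * rayFun k n μ ν x =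
      (deriv (deriv μ) x +
          Complex.I * k * (2 * (n x : ℂ) * deriv μ x + ((deriv n x : ℝ) : ℂ) * μ x)) * xiF k n x +
        (deriv (deriv ν) x -
          Complex.I * k * (2 * (n x : ℂ) * deriv ν x + ((deriv n x : ℝ) : ℂ) * ν x)) * xiInv k n x := by
  have hfirst : deriv (rayFun k n μ ν) =
      rayFun k n (fun y => deriv μ y + Complex.I * k * n y * μ y)
        (fun y => deriv ν y - Complex.I * k * n y * ν y) :=
    funext fun y => (hasDerivAt_rayFun k hn.continuous (hμ.differentiable_of_two y).hasDerivAt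
      (hν.differentiable_of_two y).hasDerivAt).deriv
  have hnx : HasDerivAt (fun y => Complex.I * (k : ℂ) * (n y : ℂ))
      (Complex.I * k * ((deriv n x : ℝ) : ℂ)) x :=
    ((hn.differentiable (by norm_num) x).hasDerivAt.ofReal_comp).const_mul _
  have hsecond := (hasDerivAt_rayFun k hn.continuous
    ((hμ.differentiable_deriv_of_two x).hasDerivAt.fun_add
      (hnx.fun_mul (hμ.differentiable_of_two x).hasDerivAt))
    ((hν.differentiable_deriv_of_two x).hasDerivAt.fun_sub
      (hnx.fun_mul (hν.differentiable_of_two x).hasDerivAt))).deriv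
  rw [hfirst, hsecond]
  simp only [rayFun]
  linear_combination (k : ℂ) ^ 2 * (n x : ℂ) ^ 2 * (μ x * xiF k n x + ν x * xiInv k n x) *
    Complex.I_sq

lemma deriv_sum_const_mul {ι : Type*} (s : Finset ι) (c : ι → ℂ) {f : ι → ℝ → ℂ}
    (hf : ∀ i ∈ s, Differentiable ℝ (f i)) :
    deriv (fun x => ∑ i ∈ s, c i * f i x) = fun x => ∑ i ∈ s, c i * deriv (f i) x :=
  funext fun x => (HasDerivAt.fun_sum fun i hi => ((hf i hi x).hasDerivAt.const_mul (c i))).deriv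

lemma differentiable_sum_const_mul {ι : Type*} (s : Finset ι) (c : ι → ℂ) {f : ι → ℝ → ℂ}
    (hf : ∀ i ∈ s, Differentiable ℝ (f i)) :
    Differentiable ℝ fun x => ∑ i ∈ s, c i * f i x :=
  Differentiable.fun_sum fun i hi => (hf i hi).const_mul (c i)

lemma deriv_sub_sum_add_sum {ι κ : Type*} (s : Finset ι) (t : Finset κ) (c : ι → ℂ) (d : κ → ℂ)
    {u : ℝ → ℂ} {f : ι → ℝ → ℂ} {g : κ → ℝ → ℂ} (hu : Differentiable ℝ u)
    (hf : ∀ i ∈ s, Differentiable ℝ (f i)) (hg : ∀ j ∈ t, Differentiable ℝ (g j)) :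
    deriv (fun x => u x - ((∑ i ∈ s, c i * f i x) + ∑ j ∈ t, d j * g j x)) =
      fun x => deriv u x - ((∑ i ∈ s, c i * deriv (f i) x) + ∑ j ∈ t, d j * deriv (g j) x) := by
  funext x
  have hF := differentiable_sum_const_mul s c hf x
  have hG := differentiable_sum_const_mul t d hg x
  rw [deriv_fun_sub (hu x) (hF.fun_add hG), deriv_fun_add hF hG, deriv_sum_const_mul s c hf,
    deriv_sum_const_mul t d hg]

/-- Boundary data of an alternating expansion: odd terms vanish and even terms cancel. -/
lemma sum_range_add_sum_Icc_of_cancel (c : ℂ) (a b : ℕ → ℂ) (m : ℕ)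
    (hodd : ∀ j, 1 ≤ j → j ≤ m → a (2 * j - 1) = 0)
    (heven : ∀ j, 1 ≤ j → j ≤ m → a (2 * j) = -b j) :
    (∑ j ∈ Finset.range (2 * m + 1), (c ^ j)⁻¹ * a j) +
      ∑ j ∈ Finset.Icc 1 m, (c ^ (2 * j))⁻¹ * b j = a 0 := by
  induction m with
  | zero => simp
  | succ m ih =>
    have ih' := ih (fun j h1 h2 => hodd j h1 (by omega)) (fun j h1 h2 => heven j h1 (by omega))
    have h1 : a (2 * m + 1) = 0 := hodd (m + 1) (by omega) le_rfl
    have h2 : a (2 * m + 2) = -b (m + 1) := heven (m + 1) (by omega) le_rfl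
    rw [show 2 * (m + 1) + 1 = 2 * m + 1 + 1 + 1 by ring, Finset.sum_range_succ,
      Finset.sum_range_succ, Finset.sum_Icc_succ_top (by omega), h1, h2,
      show 2 * (m + 1) = 2 * m + 1 + 1 by ring]
    linear_combination ih'

lemma sum_range_inv_pow_telescope {c : ℂ} (hc : c ≠ 0) (a A : ℕ → ℂ) (M : ℕ)
    (hzero : a 0 = A 0) (hsucc : ∀ j < M, a (j + 1) = A (j + 1) - c * A j) :
    ∑ j ∈ Finset.range (M + 1), (c ^ j)⁻¹ * a j = (c ^ M)⁻¹ * A M := by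
  induction M with
  | zero => simp [hzero]
  | succ M ih =>
    rw [Finset.sum_range_succ, ih fun j hj => hsucc j (by omega), hsucc M (by omega)]
    field_simp
    ring

lemma sum_Icc_inv_pow_telescope {c : ℂ} (hc : c ≠ 0) (b B : ℕ → ℂ) (m : ℕ)
    (hstep : ∀ j, 1 ≤ j → j ≤ m → b j = c ^ 2 * B j - B (j + 1)) :
    ∑ j ∈ Finset.Icc 1 m, (c ^ (2 * j))⁻¹ * b j = B 1 - (c ^ (2 * m))⁻¹ * B (m + 1) := by
  induction m with
  | zero => simp
  | succ m ih =>
    rw [Finset.sum_Icc_succ_top (by omega), ih fun j h1 h2 => hstep j h1 (by omega),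
      hstep (m + 1) (by omega) le_rfl]
    field_simp
    ring

/-- equations (5.24), (5.29) of the paper: the error
`e = u - ũ^m` of the hybrid numerical-asymptotic approximation satisfies
`L e = k^{-2m}(n² F_{2m+2} - μ_{2m}'' ξ - ν_{2m}'' ξ^{-1})` on `[0,1]` together with the
homogeneous boundary conditions `e(0) = 0`, `e'(1) - i k n_∞ e(1) = 0`.
Here `G j` plays the role of `F_{2j}`. -/
theorem hybrid_error_equation (k : ℝ) (hk : 0 < k)
    (n : ℝ → ℝ) (hn : ContDiff ℝ 1 n) (hnz : ∀ x ∈ Set.Icc (0 : ℝ) 1, n x ≠ 0)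
    (nInf : ℝ) (uL : ℂ) (m : ℕ) (hm : 1 ≤ m) (F : ℝ → ℂ)
    -- (a) the exact solution
    (u : ℝ → ℂ) (hu : ContDiff ℝ 2 u)
    (huEq : ∀ x ∈ Set.Icc (0 : ℝ) 1,
        deriv (deriv u) x + (k : ℂ) ^ 2 * ((n x : ℂ)) ^ 2 * u x = F x)
    (huBL : u 0 = uL) (huBR : BR k nInf u = 0)
    -- (b) the transport recurrences and boundary conditions for r_j = μ_j ξ + ν_j ξ⁻¹
    (μ ν : ℕ → ℝ → ℂ)
    (hμs : ∀ j ≤ 2 * m, ContDiff ℝ 2 (μ j)) (hνs : ∀ j ≤ 2 * m, ContDiff ℝ 2 (ν j))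
    (hμrec : ∀ j ≤ 2 * m, ∀ x ∈ Set.Icc (0 : ℝ) 1,
        2 * (n x : ℂ) * deriv (μ j) x + ((deriv n x : ℝ) : ℂ) * μ j x =
          Complex.I * (if j = 0 then 0 else deriv (deriv (μ (j - 1))) x))
    (hνrec : ∀ j ≤ 2 * m, ∀ x ∈ Set.Icc (0 : ℝ) 1,
        2 * (n x : ℂ) * deriv (ν j) x + ((deriv n x : ℝ) : ℂ) * ν j x =
          -(Complex.I * (if j = 0 then 0 else deriv (deriv (ν (j - 1))) x)))
    (G : ℕ → ℝ → ℂ)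
    (hBL0 : rayFun k n (μ 0) (ν 0) 0 = uL)
    (hBR0 : BR k nInf (rayFun k n (μ 0) (ν 0)) = 0)
    (hBLodd : ∀ j, 1 ≤ j → j ≤ m → rayFun k n (μ (2 * j - 1)) (ν (2 * j - 1)) 0 = 0)
    (hBRodd : ∀ j, 1 ≤ j → j ≤ m → BR k nInf (rayFun k n (μ (2 * j - 1)) (ν (2 * j - 1))) = 0)
    (hBLeven : ∀ j, 1 ≤ j → j ≤ m → rayFun k n (μ (2 * j)) (ν (2 * j)) 0 = -(G j 0))
    (hBReven : ∀ j, 1 ≤ j → j ≤ m →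
        BR k nInf (rayFun k n (μ (2 * j)) (ν (2 * j))) = -(BR k nInf (G j)))
    -- (c) the recursion for F_{2j}
    (hGs : ∀ j, 1 ≤ j → j ≤ m → ContDiff ℝ 2 (G j))
    (hG1 : ∀ x ∈ Set.Icc (0 : ℝ) 1, G 1 x = F x / ((n x : ℂ)) ^ 2)
    (hGrec : ∀ j, 1 ≤ j → j ≤ m → ∀ x ∈ Set.Icc (0 : ℝ) 1,
        G (j + 1) x = -(deriv (deriv (G j)) x) / ((n x : ℂ)) ^ 2) :
    -- conclusion, with e = u - ũ^m
    let e : ℝ → ℂ := fun x => u x -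
      ((∑ j ∈ Finset.range (2 * m + 1), ((k : ℂ) ^ j)⁻¹ * rayFun k n (μ j) (ν j) x) +
        ∑ j ∈ Finset.Icc 1 m, ((k : ℂ) ^ (2 * j))⁻¹ * G j x)
    (∀ x ∈ Set.Icc (0 : ℝ) 1,
        deriv (deriv e) x + (k : ℂ) ^ 2 * ((n x : ℂ)) ^ 2 * e x =
          ((k : ℂ) ^ (2 * m))⁻¹ *
            (((n x : ℂ)) ^ 2 * G (m + 1) x - deriv (deriv (μ (2 * m))) x * xiF k n x -
              deriv (deriv (ν (2 * m))) x * xiInv k n x)) ∧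
      e 0 = 0 ∧ BR k nInf e = 0 := by
  have hkC : (k : ℂ) ≠ 0 := Complex.ofReal_ne_zero.mpr hk.ne'
  have hr : ∀ j ∈ Finset.range (2 * m + 1), ContDiff ℝ 2 (rayFun k n (μ j) (ν j)) := by
    intro j hj
    have hj' : j ≤ 2 * m := by simpa [Nat.lt_succ_iff] using hj
    exact contDiff_rayFun k hn (hμs j hj') (hνs j hj')
  have hG : ∀ j ∈ Finset.Icc 1 m, ContDiff ℝ 2 (G j) := fun j hj =>
    hGs j (Finset.mem_Icc.mp hj).1 (Finset.mem_Icc.mp hj).2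
  intro e
  have he1 : deriv e = fun x => deriv u x -
      ((∑ j ∈ Finset.range (2 * m + 1), ((k : ℂ) ^ j)⁻¹ * deriv (rayFun k n (μ j) (ν j)) x) +
        ∑ j ∈ Finset.Icc 1 m, ((k : ℂ) ^ (2 * j))⁻¹ * deriv (G j) x) :=
    deriv_sub_sum_add_sum _ _ _ _ hu.differentiable_of_two
      (fun j hj => (hr j hj).differentiable_of_two) (fun j hj => (hG j hj).differentiable_of_two)
  have he2 : deriv (deriv e) = fun x => deriv (deriv u) x -
      ((∑ j ∈ Finset.range (2 * m + 1),
          ((k : ℂ) ^ j)⁻¹ * deriv (deriv (rayFun k n (μ j) (ν j))) x) +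
        ∑ j ∈ Finset.Icc 1 m, ((k : ℂ) ^ (2 * j))⁻¹ * deriv (deriv (G j)) x) := by
    rw [he1]
    exact deriv_sub_sum_add_sum _ _ _ _ hu.differentiable_deriv_of_two
      (fun j hj => (hr j hj).differentiable_deriv_of_two)
      (fun j hj => (hG j hj).differentiable_deriv_of_two)
  refine ⟨fun x hx => ?_, ?_, ?_⟩
  · have hnx : (n x : ℂ) ≠ 0 := Complex.ofReal_ne_zero.mpr (hnz x hx)
    have hray := sum_range_inv_pow_telescope hkC
      (fun j => deriv (deriv (rayFun k n (μ j) (ν j))) x +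
        (k : ℂ) ^ 2 * (n x : ℂ) ^ 2 * rayFun k n (μ j) (ν j) x)
      (fun j => deriv (deriv (μ j)) x * xiF k n x + deriv (deriv (ν j)) x * xiInv k n x)
      (2 * m)
      (by
        have hμ0 := hμrec 0 (by omega) x hx
        have hν0 := hνrec 0 (by omega) x hx
        simp only [if_true] at hμ0 hν0
        rw [helmholtz_rayFun k hn (hμs 0 (by omega)) (hνs 0 (by omega)), hμ0, hν0]
        ring)
      (by
        intro j hj
        have hμj := hμrec (j + 1) (by omega) x hx
        have hνj := hνrec (j + 1) (by omega) x hx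
        simp only [Nat.add_eq_zero_iff, one_ne_zero, and_false, if_false,
          Nat.add_sub_cancel] at hμj hνj
        rw [helmholtz_rayFun k hn (hμs _ (by omega)) (hνs _ (by omega)), hμj, hνj]
        linear_combination (k : ℂ) * (deriv (deriv (μ j)) x * xiF k n x +
          deriv (deriv (ν j)) x * xiInv k n x) * Complex.I_sq)
    have hsource := sum_Icc_inv_pow_telescope hkC
      (fun j => deriv (deriv (G j)) x + (k : ℂ) ^ 2 * (n x : ℂ) ^ 2 * G j x)
      (fun j => (n x : ℂ) ^ 2 * G j x) m
      (by
        intro j h1 h2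
        simp only [hGrec j h1 h2 x hx]
        field_simp
        ring)
    have hF : (n x : ℂ) ^ 2 * G 1 x = F x := by
      rw [hG1 x hx]
      field_simp
    simp only [mul_add, Finset.sum_add_distrib, mul_left_comm _ ((k : ℂ) ^ 2 * (n x : ℂ) ^ 2),
      ← Finset.mul_sum] at hray hsource
    simp only [he2, e]
    linear_combination huEq x hx - hray - hsource - hF
  · have h := sum_range_add_sum_Icc_of_cancel (k : ℂ) (fun j => rayFun k n (μ j) (ν j) 0)
      (fun j => G j 0) m hBLodd hBLeven
    simp only [e]
    linear_combination huBL - h - hBL0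
  · have h := sum_range_add_sum_Icc_of_cancel (k : ℂ)
      (fun j => BR k nInf (rayFun k n (μ j) (ν j))) (fun j => BR k nInf (G j)) m hBRodd hBReven
    simp only [BR] at h huBR hBR0 ⊢
    simp only [mul_sub, Finset.sum_sub_distrib,
      mul_left_comm _ (Complex.I * (k : ℂ) * (nInf : ℂ)), ← Finset.mul_sum] at h
    simp only [he1, e]
    linear_combination huBR - h - hBR0
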